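/- Suppose M : ℝ → ℂ is a continuous, integrable function that is not identically zero and belongs to the class M̃_{(p₁,p₂,p₃)}. Then 1/p₃ ≤ 1/p₁ + 1/p₂ ≤ 1/p₃ + 1. -/

import Mathlib

open MeasureTheory Set ENNReal

noncomputable def FT (f : ℝ → ℂ) (ξ : ℝ) : ℂ :=
  ∫ x : ℝ, Complex.exp (-(2 * Real.pi * x * ξ) * Complex.I) * f x

noncomputable def FT2 (Φ : ℝ × ℝ → ℂ) (ξη : ℝ × ℝ) : ℂ :=
  ∫ uv : ℝ × ℝ, Complex.exp (-(2 * Real.pi * (ξη.1 * uv.1 + ξη.2 * uv.2)) * Complex.I) * Φ uv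

/-- The class `𝒫(ℝ)`: Schwartz functions whose Fourier transform has compact support. -/
def MemP (f : ℝ → ℂ) : Prop :=
  (∃ φ : SchwartzMap ℝ ℂ, ⇑φ = f) ∧ HasCompactSupport (FT f)

/-- The bilinear operator associated to a symbol `m` on `ℝ × ℝ`. -/
noncomputable def Bm (m : ℝ × ℝ → ℂ) (f g : ℝ → ℂ) (x : ℝ) : ℂ :=
  ∫ ξη : ℝ × ℝ, FT f ξη.1 * FT g ξη.2 * m ξη *
    Complex.exp ((2 * Real.pi * (ξη.1 + ξη.2) * x) * Complex.I)

/-- `m` is a bilinear multiplier of type `(p₁, p₂, p₃)`. -/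
def IsBiMult (p₁ p₂ p₃ : ℝ≥0∞) (m : ℝ × ℝ → ℂ) : Prop :=
  ∃ C : ℝ, 0 < C ∧ ∀ f g : ℝ → ℂ, MemP f → MemP g →
    eLpNorm (Bm m f g) p₃ volume ≤
      ENNReal.ofReal C * eLpNorm f p₁ volume * eLpNorm g p₂ volume

/-- The multiplier norm `‖m‖_{(p₁,p₂,p₃)}`: the least admissible constant. -/
noncomputable def biNorm (p₁ p₂ p₃ : ℝ≥0∞) (m : ℝ × ℝ → ℂ) : ℝ :=
  sInf {C : ℝ | 0 ≤ C ∧ ∀ f g : ℝ → ℂ, MemP f → MemP g →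
    eLpNorm (Bm m f g) p₃ volume ≤
      ENNReal.ofReal C * eLpNorm f p₁ volume * eLpNorm g p₂ volume}

open Filter Topology FourierTransform ContDiff

noncomputable def unitExp (x : ℝ) : ℂ := Complex.exp ((2 * Real.pi * x : ℝ) * Complex.I)

lemma unitExp_add (x y : ℝ) : unitExp (x + y) = unitExp x * unitExp y := by
  rw [unitExp, unitExp, unitExp, ← Complex.exp_add]
  push_cast
  ring_nf

lemma unitExp_zero : unitExp 0 = 1 := by simp [unitExp]

lemma norm_unitExp (x : ℝ) : ‖unitExp x‖ = 1 := Complex.norm_exp_ofReal_mul_I _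

lemma contDiff_unitExp : ContDiff ℝ ∞ unitExp := by
  unfold unitExp
  exact ((Complex.ofRealCLM.contDiff.comp (contDiff_const.mul contDiff_id)).mul
    contDiff_const).cexp

@[fun_prop]
lemma continuous_unitExp : Continuous unitExp := contDiff_unitExp.continuous

lemma FT_eq_fourier (f : ℝ → ℂ) : FT f = 𝓕 f := by
  ext ξ
  rw [Real.fourier_eq', FT]
  congr 1 with x
  rw [smul_eq_mul]
  congr 2
  simp
  ring

lemma exists_integral_unitExp_mul_ne_zero {M : ℝ → ℂ} (hcont : Continuous M)
    (hint : Integrable M) (hne : M ≠ 0) : ∃ t : ℝ, ∫ v, unitExp (-(t * v)) * M v ≠ 0 := by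
  by_contra! h
  have h0 : 𝓕 M = 0 := by
    ext t
    rw [← FT_eq_fourier, FT, Pi.zero_apply, ← h t]
    congr 1 with v
    rw [unitExp]
    congr 2
    push_cast
    ring
  apply hne
  rw [← hcont.fourierInv_fourier_eq hint (by rw [h0]; exact integrable_zero _ _ _), h0]
  ext v
  simp [Real.fourierInv_eq']

lemma integral_comp_shear_scale (G : ℝ × ℝ → ℂ) {R : ℝ} (hR : 0 < R) :
    ∫ p, G p = (R⁻¹ : ℝ) • ∫ q : ℝ × ℝ, G (q.1 + R⁻¹ * q.2, R⁻¹ * q.2) := by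
  have h1 : ∫ p, G p = ∫ q : ℝ × ℝ, G (q.1 + q.2, q.2) := by
    rw [Measure.volume_eq_prod]
    refine ((measurePreserving_add_prod volume volume).integral_comp ?_ G).symm
    exact (Homeomorph.mk (Equiv.mk (fun z : ℝ × ℝ => (z.1 + z.2, z.2))
      (fun z => (z.1 - z.2, z.2)) (fun z => by simp) (fun z => by simp))
      (by fun_prop) (by fun_prop)).measurableEmbedding
  have h2 : (volume : Measure (ℝ × ℝ)).map (Prod.map id (R⁻¹ * ·)) =
      ENNReal.ofReal R • volume := by
    rw [Measure.volume_eq_prod, ← Measure.map_prod_map _ _ measurable_id (by fun_prop),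
      Measure.map_id, Real.map_volume_mul_left (inv_ne_zero hR.ne'), inv_inv, abs_of_pos hR,
      Measure.prod_smul_right]
  have h3 : MeasurableEmbedding (Prod.map id (R⁻¹ * ·) : ℝ × ℝ → ℝ × ℝ) :=
    MeasurableEmbedding.id.prodMap (measurableEmbedding_mulLeft₀ (inv_ne_zero hR.ne'))
  have h4 := h3.integral_map (μ := volume) (fun q : ℝ × ℝ => G (q.1 + q.2, q.2))
  rw [h2, integral_smul_measure, ENNReal.toReal_ofReal hR.le] at h4
  simp only [Prod.map_fst, Prod.map_snd, id] at h4
  rw [h1, ← h4, smul_smul, inv_mul_cancel₀ hR.ne', one_smul]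

lemma integral_comp_scale_translate (G : ℝ × ℝ → ℂ) {R : ℝ} (hR : 0 < R) (a : ℝ) :
    ∫ p, G p = ((R⁻¹) ^ 2 : ℝ) • ∫ q : ℝ × ℝ, G (a + R⁻¹ * q.1, R⁻¹ * q.2) := by
  have h := Measure.integral_comp_smul (volume : Measure (ℝ × ℝ)) (fun q => G ((a, 0) + q)) R⁻¹
  rw [integral_add_left_eq_self G] at h
  simp only [Module.finrank_prod, Module.finrank_self] at h
  have : ∀ q : ℝ × ℝ, (a, (0 : ℝ)) + R⁻¹ • q = (a + R⁻¹ * q.1, R⁻¹ * q.2) := by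
    intro q; ext <;> simp
  simp only [this] at h
  rw [h, one_add_one_eq_two, smul_smul, abs_of_pos (by positivity),
    mul_inv_cancel₀ (by positivity), one_smul]

lemma eLpNorm_comp_mul_left (f : ℝ → ℂ) (p : ℝ≥0∞) {R : ℝ} (hR : 0 < R) :
    eLpNorm (fun y => f (R * y)) p volume =
      ENNReal.ofReal (R ^ (-(1 / p).toReal)) * eLpNorm f p volume := by
  have h := (measurableEmbedding_mulLeft₀ hR.ne').eLpNorm_map_measure (g := f) (p := p)
    (μ := volume)
  rw [Real.map_volume_mul_left hR.ne', eLpNorm_smul_measure_of_ne_zero (by simp [hR.ne'])] at h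
  rw [abs_of_pos (inv_pos.2 hR), smul_eq_mul, ENNReal.ofReal_rpow_of_pos (inv_pos.2 hR),
    Real.inv_rpow hR.le, ← Real.rpow_neg hR.le] at h
  exact h.symm

noncomputable def freqBump : ContDiffBump (0 : ℝ) := ⟨1, 2, one_pos, one_lt_two⟩

/-- The Fourier transform of `packet R a t`: a bump of width `R⁻¹` around the frequency `a`,
modulated so that the packet lives at scale `R` around the position `t`. -/
noncomputable def packetHat (R a t ξ : ℝ) : ℂ :=
  R * unitExp (-(t * ξ)) * (freqBump (R * (ξ - a)) : ℝ)

noncomputable def packet (R a t x : ℝ) : ℂ := ∫ ξ, unitExp (ξ * x) * packetHat R a t ξ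

@[fun_prop]
lemma continuous_freqBump : Continuous (freqBump : ℝ → ℝ) := freqBump.continuous

lemma contDiff_packetHat (R a t : ℝ) : ContDiff ℝ ∞ (packetHat R a t) := by
  unfold packetHat
  refine (contDiff_const.mul (contDiff_unitExp.comp ?_)).mul
    (Complex.ofRealCLM.contDiff.comp (freqBump.contDiff.comp ?_)) <;> fun_prop

lemma hasCompactSupport_packetHat {R : ℝ} (hR : 0 < R) (a t : ℝ) :
    HasCompactSupport (packetHat R a t) := by
  have h : HasCompactSupport (fun ξ : ℝ => freqBump (R * (ξ - a))) :=
    freqBump.hasCompactSupport.comp_homeomorph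
      ((Homeomorph.subRight a).trans (Homeomorph.mulLeft₀ R hR.ne'))
  exact (h.comp_left (g := fun x : ℝ => (x : ℂ)) (by simp)).mul_left

lemma exists_schwartz_packet {R : ℝ} (hR : 0 < R) (a t : ℝ) :
    ∃ φ : SchwartzMap ℝ ℂ, ⇑φ = packet R a t ∧ FT (packet R a t) = packetHat R a t := by
  set h := (hasCompactSupport_packetHat hR a t).toSchwartzMap (contDiff_packetHat R a t)
  have hh : ⇑h = packetHat R a t := rfl
  have h1 : ⇑(𝓕⁻ h : SchwartzMap ℝ ℂ) = packet R a t := by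
    rw [SchwartzMap.fourierInv_coe, hh]
    ext x
    rw [Real.fourierInv_eq', packet]
    congr 1 with ξ
    simp [unitExp, mul_comm, mul_left_comm]
  refine ⟨𝓕⁻ h, h1, ?_⟩
  rw [FT_eq_fourier, ← h1, ← SchwartzMap.fourier_coe, FourierTransform.fourier_fourierInv_eq, hh]

lemma FT_packet {R : ℝ} (hR : 0 < R) (a t : ℝ) : FT (packet R a t) = packetHat R a t :=
  (exists_schwartz_packet hR a t).choose_spec.2

lemma memP_packet {R : ℝ} (hR : 0 < R) (a t : ℝ) : MemP (packet R a t) := by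
  obtain ⟨φ, h1, h2⟩ := exists_schwartz_packet hR a t
  exact ⟨⟨φ, h1⟩, h2 ▸ hasCompactSupport_packetHat hR a t⟩

lemma continuous_packet {R : ℝ} (hR : 0 < R) (a t : ℝ) : Continuous (packet R a t) := by
  obtain ⟨φ, h1, -⟩ := exists_schwartz_packet hR a t
  exact h1 ▸ φ.continuous

lemma eLpNorm_packet_one_lt_top (p : ℝ≥0∞) : eLpNorm (packet 1 0 0) p volume < ⊤ := by
  obtain ⟨φ, h1, -⟩ := exists_schwartz_packet one_pos 0 0
  exact h1 ▸ (φ.memLp p volume).2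

lemma norm_packet_comp_mul {R : ℝ} (hR : 0 < R) (a t y : ℝ) :
    ‖packet R a t (R * y)‖ = ‖packet 1 0 0 (y - t / R)‖ := by
  have key : packet R a t (R * y) = unitExp (a * R * y - a * t) * packet 1 0 0 (y - t / R) := by
    rw [packet, packet, ← integral_const_mul]
    have h1 := integral_add_right_eq_self (μ := volume)
      (fun ξ => unitExp (ξ * (R * y)) * packetHat R a t ξ) a
    have h2 := Measure.integral_comp_mul_left
      (fun ξ => unitExp ((ξ + a) * (R * y)) * packetHat R a t (ξ + a)) R⁻¹
    rw [inv_inv, abs_of_pos hR, h1] at h2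
    rw [← inv_smul_smul₀ hR.ne' (∫ ξ, unitExp (ξ * (R * y)) * packetHat R a t ξ), ← h2,
      ← integral_smul]
    congr 1 with ξ
    have e : unitExp ((R⁻¹ * ξ + a) * (R * y)) * unitExp (-(t * (R⁻¹ * ξ + a))) =
        unitExp (a * R * y - a * t) * unitExp (ξ * (y - t / R)) := by
      rw [← unitExp_add, ← unitExp_add]
      congr 1
      field_simp
      ring
    have hb : R * (R⁻¹ * ξ + a - a) = ξ := by field_simp; ring
    have hR' : (R : ℂ) ≠ 0 := by exact_mod_cast hR.ne'
    simp only [packetHat, hb, zero_mul, neg_zero, unitExp_zero, Complex.ofReal_one, one_mul,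
      sub_zero, Complex.real_smul, Complex.ofReal_inv]
    rw [← mul_assoc (unitExp _) (unitExp _), ← e]
    field_simp
  rw [key, norm_mul, norm_unitExp, one_mul]

lemma eLpNorm_packet {R : ℝ} (hR : 0 < R) (a t : ℝ) (p : ℝ≥0∞) :
    eLpNorm (packet R a t) p volume =
      ENNReal.ofReal (R ^ (1 / p).toReal) * eLpNorm (packet 1 0 0) p volume := by
  have h1 := eLpNorm_comp_mul_left (packet R a t) p hR
  have h2 : eLpNorm (fun y => packet R a t (R * y)) p volume =
      eLpNorm (packet 1 0 0) p volume := by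
    rw [eLpNorm_congr_norm_ae (.of_forall (norm_packet_comp_mul hR a t))]
    exact eLpNorm_comp_measurePreserving (g := packet 1 0 0) (f := fun y => y - t / R)
      (continuous_packet one_pos 0 0).aestronglyMeasurable
      (measurePreserving_sub_right volume (t / R))
  rw [← h2, h1, ← mul_assoc, ← ENNReal.ofReal_mul (by positivity), ← Real.rpow_add hR]
  simp

/-- The multiplier inequality tested on two packets at scale `R`. -/
lemma IsBiMult.exists_bound_packet {p₁ p₂ p₃ : ℝ≥0∞} {m : ℝ × ℝ → ℂ}
    (hm : IsBiMult p₁ p₂ p₃ m) : ∃ K : ℝ, ∀ R : ℝ, 0 < R → ∀ a t a' t' : ℝ,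
      eLpNorm (fun y => Bm m (packet R a t) (packet R a' t') (R * y)) p₃ volume ≤
        ENNReal.ofReal
          (K * R ^ ((1 / p₁).toReal + (1 / p₂).toReal - (1 / p₃).toReal)) := by
  obtain ⟨C, hC, h⟩ := hm
  set k₁ := (eLpNorm (packet 1 0 0) p₁ volume).toReal
  set k₂ := (eLpNorm (packet 1 0 0) p₂ volume).toReal
  refine ⟨C * k₁ * k₂, fun R hR a t a' t' => ?_⟩
  rw [eLpNorm_comp_mul_left _ _ hR]
  refine (mul_le_mul_right (h _ _ (memP_packet hR a t) (memP_packet hR a' t')) _).trans ?_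
  rw [eLpNorm_packet hR, eLpNorm_packet hR a',
    ← ENNReal.ofReal_toReal (eLpNorm_packet_one_lt_top p₁).ne,
    ← ENNReal.ofReal_toReal (eLpNorm_packet_one_lt_top p₂).ne,
    ← ENNReal.ofReal_mul (by positivity), ← ENNReal.ofReal_mul (by positivity),
    ← ENNReal.ofReal_mul (by positivity), ← ENNReal.ofReal_mul (by positivity),
    ← ENNReal.ofReal_mul (by positivity)]
  apply le_of_eq
  congr 1
  rw [sub_eq_add_neg, Real.rpow_add hR, Real.rpow_add hR]
  ring

/-- Fatou's lemma: a nonzero limit cannot have approximants whose norms tend to zero. -/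
lemma not_tendsto_zero_of_eLpNorm_le {p : ℝ≥0∞} (hp : 0 < p) {H : ℕ → ℝ → ℂ} {G : ℝ → ℂ}
    {c : ℕ → ℝ} (hH : ∀ n, AEStronglyMeasurable (H n) volume)
    (hlim : ∀ y, Tendsto (fun n => H n y) atTop (𝓝 (G y))) (hG : Continuous G) (hG0 : G 0 ≠ 0)
    (hbound : ∀ n, eLpNorm (H n) p volume ≤ ENNReal.ofReal (c n)) :
    ¬ Tendsto c atTop (𝓝 0) := by
  intro hc
  have h0 : eLpNorm G p volume = 0 := by
    refine le_antisymm (ENNReal.le_of_forall_pos_le_add fun ε hε _ => ?_) zero_le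
    rw [zero_add]
    refine Lp.eLpNorm_le_of_ae_tendsto (u := atTop) (f := H) ?_ hH (.of_forall hlim)
    filter_upwards [hc.eventually (ge_mem_nhds (show (0 : ℝ) < ε from hε))] with n hn
    exact (hbound n).trans (by simpa using ENNReal.ofReal_le_ofReal hn)
  rw [eLpNorm_eq_zero_iff hG.aestronglyMeasurable hp.ne'] at h0
  exact hG0 (congrFun ((hG.ae_eq_iff_eq volume continuous_const).1 h0) 0)

section Oscillatory

variable {α : Type*} [TopologicalSpace α] [MeasurableSpace α] [OpensMeasurableSpace α] {μ : Measure α}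

lemma continuous_integral_mul_unitExp {f : α → ℂ} (hf : Integrable f μ) {u : α → ℝ}
    (hu : Continuous u) : Continuous fun y : ℝ => ∫ q, f q * unitExp (u q * y) ∂μ := by
  refine continuous_of_dominated (bound := fun q => ‖f q‖) (fun y => ?_) (fun y => ?_) hf.norm ?_
  · have : Continuous fun q => unitExp (u q * y) := by fun_prop
    exact hf.1.mul this.aestronglyMeasurable
  · exact .of_forall fun q => by rw [norm_mul, norm_unitExp, mul_one]
  · exact .of_forall fun q => by fun_prop

lemma not_tendsto_zero_of_eLpNorm_integral_le [SecondCountableTopology α] {p : ℝ≥0∞}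
    (hp : 0 < p) {f : ℕ → α → ℂ} {F : α → ℂ} {u : ℕ → α → ℝ} {U : α → ℝ} {bound : α → ℝ} {c : ℕ → ℝ}
    (hf : ∀ n, Continuous (f n)) (hF : Continuous F) (hu : ∀ n, Continuous (u n))
    (hU : Continuous U) (hfF : ∀ q, Tendsto (fun n => f n q) atTop (𝓝 (F q)))
    (huU : ∀ q, Tendsto (fun n => u n q) atTop (𝓝 (U q))) (hb : Integrable bound μ)
    (hfb : ∀ n q, ‖f n q‖ ≤ bound q) (hF0 : ∫ q, F q ∂μ ≠ 0)
    (hbound : ∀ n, eLpNorm (fun y : ℝ => ∫ q, f n q * unitExp (u n q * y) ∂μ) p volume ≤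
      ENNReal.ofReal (c n)) : ¬ Tendsto c atTop (𝓝 0) := by
  have hfi : ∀ n, Integrable (f n) μ := fun n =>
    hb.mono' (hf n).aestronglyMeasurable (.of_forall (hfb n))
  have hFi : Integrable F μ := hb.mono' hF.aestronglyMeasurable
    (.of_forall fun q => le_of_tendsto (hfF q).norm (.of_forall fun n => hfb n q))
  refine not_tendsto_zero_of_eLpNorm_le hp (G := fun y => ∫ q, F q * unitExp (U q * y) ∂μ)
    (fun n => (continuous_integral_mul_unitExp (hfi n) (hu n)).aestronglyMeasurable)
    (fun y => ?_) (continuous_integral_mul_unitExp hFi hU) (by simpa [unitExp_zero]) hbound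
  refine tendsto_integral_of_dominated_convergence bound (fun n => ?_) hb
    (fun n => .of_forall fun q => ?_) (.of_forall fun q => ?_)
  · have := hf n
    have := hu n
    exact (by fun_prop : Continuous _).aestronglyMeasurable
  · rw [norm_mul, norm_unitExp, mul_one]
    exact hfb n q
  · exact (hfF q).mul ((continuous_unitExp.tendsto _).comp ((huU q).mul_const y))

end Oscillatory

lemma Bm_eq_integral_unitExp (m : ℝ × ℝ → ℂ) {R : ℝ} (hR : 0 < R) (a t a' t' x : ℝ) :
    Bm m (packet R a t) (packet R a' t') x = ∫ p : ℝ × ℝ,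
      packetHat R a t p.1 * packetHat R a' t' p.2 * m p * unitExp ((p.1 + p.2) * x) := by
  rw [Bm, FT_packet hR, FT_packet hR]
  congr 1 with p
  rw [unitExp]
  push_cast
  congr 3
  ring

lemma norm_Bm_modulated_packet (M : ℝ → ℂ) {R : ℝ} (hR : 0 < R) (a y : ℝ) :
    ‖Bm (fun ξη => M (ξη.1 - ξη.2)) (packet R a 0) (packet R 0 0) (R * y)‖ =
      ‖∫ q : ℝ × ℝ, (freqBump q.1 : ℂ) * (freqBump q.2 : ℂ) * M (a + R⁻¹ * (q.1 - q.2)) *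
        unitExp ((q.1 + q.2) * y)‖ := by
  have hR' : (R : ℂ) ≠ 0 := by exact_mod_cast hR.ne'
  rw [Bm_eq_integral_unitExp _ hR, integral_comp_scale_translate _ hR a, ← integral_smul,
    ← one_mul ‖∫ q : ℝ × ℝ, (freqBump q.1 : ℂ) * _ * _ * _‖, ← norm_unitExp (a * R * y),
    ← norm_mul, ← integral_const_mul]
  congr 2 with q
  have e : unitExp ((a + R⁻¹ * q.1 + R⁻¹ * q.2) * (R * y)) =
      unitExp (a * R * y) * unitExp ((q.1 + q.2) * y) := by
    rw [← unitExp_add]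
    congr 1
    field_simp
    ring
  have h1 : R * (a + R⁻¹ * q.1 - a) = q.1 := by field_simp; ring
  have h2 : R * (R⁻¹ * q.2 - 0) = q.2 := by field_simp; ring
  have h3 : a + R⁻¹ * q.1 - R⁻¹ * q.2 = a + R⁻¹ * (q.1 - q.2) := by ring
  simp only [packetHat, h1, h2, h3, e, zero_mul, neg_zero, unitExp_zero, mul_one,
    Complex.real_smul, Complex.ofReal_pow, Complex.ofReal_inv]
  field_simp

lemma Bm_translated_packet (M : ℝ → ℂ) {R : ℝ} (hR : 0 < R) (t y : ℝ) :
    Bm (fun ξη => M (ξη.1 - ξη.2)) (packet R 0 t) (packet R 0 (-t)) (R * y) =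
      R * ∫ q : ℝ × ℝ, (freqBump (R * q.1 + q.2) : ℂ) * (freqBump q.2 : ℂ) *
        (unitExp (-(t * q.1)) * M q.1) * unitExp ((R * q.1 + 2 * q.2) * y) := by
  have hR' : (R : ℂ) ≠ 0 := by exact_mod_cast hR.ne'
  rw [Bm_eq_integral_unitExp _ hR, integral_comp_shear_scale _ hR, ← integral_smul,
    ← integral_const_mul]
  congr 1 with q
  have e : unitExp (-(t * (q.1 + R⁻¹ * q.2))) * unitExp (-(-t * (R⁻¹ * q.2))) =
      unitExp (-(t * q.1)) := by
    rw [← unitExp_add]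
    congr 1
    ring
  have h1 : R * (q.1 + R⁻¹ * q.2 - 0) = R * q.1 + q.2 := by field_simp; ring
  have h2 : R * (R⁻¹ * q.2 - 0) = q.2 := by field_simp; ring
  have h3 : q.1 + R⁻¹ * q.2 - R⁻¹ * q.2 = q.1 := by ring
  have h4 : (q.1 + R⁻¹ * q.2 + R⁻¹ * q.2) * (R * y) = (R * q.1 + 2 * q.2) * y := by
    field_simp
    ring
  simp only [packetHat, h1, h2, h3, h4, ← e, Complex.real_smul, Complex.ofReal_inv]
  field_simp

lemma integrable_freqBump : Integrable (freqBump : ℝ → ℝ) := freqBump.integrable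

lemma freqBump_le_one (x : ℝ) : freqBump x ≤ 1 := freqBump.le_one

lemma norm_freqBump (x : ℝ) : ‖(freqBump x : ℂ)‖ = freqBump x := by
  rw [Complex.norm_real, Real.norm_of_nonneg freqBump.nonneg]

lemma integral_freqBump_ne_zero : ∫ x, (freqBump x : ℂ) ≠ 0 := by
  rw [integral_complex_ofReal]
  exact_mod_cast freqBump.integral_pos.ne'

lemma integral_freqBump_sq_ne_zero : ∫ x, (freqBump x : ℂ) * (freqBump x : ℂ) ≠ 0 := by
  have h : 0 < ∫ x, freqBump x * freqBump x := by
    refine Continuous.integral_pos_of_hasCompactSupport_nonneg_nonzero (x := 0) (by fun_prop)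
      freqBump.hasCompactSupport.mul_left (fun x => mul_self_nonneg _) ?_
    exact (mul_pos (freqBump.pos_of_mem_ball (by simp [freqBump]))
      (freqBump.pos_of_mem_ball (by simp [freqBump]))).ne'
  simp_rw [← Complex.ofReal_mul]
  rw [integral_complex_ofReal]
  exact_mod_cast h.ne'

lemma tendsto_const_mul_add_one_rpow_neg (K : ℝ) {δ : ℝ} (hδ : δ < 0) :
    Tendsto (fun n : ℕ => K * ((n : ℝ) + 1) ^ δ) atTop (𝓝 0) := by
  have h := (tendsto_rpow_neg_atTop (neg_pos.2 hδ)).comp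
    (tendsto_natCast_atTop_atTop.atTop_add (tendsto_const_nhds (x := (1 : ℝ))))
  simpa using h.const_mul K

lemma exponent_target_le_of_isBiMult {p₁ p₂ p₃ : ℝ≥0∞} (hp₃ : 0 < p₃) {M : ℝ → ℂ}
    (hcont : Continuous M) (hne : M ≠ 0)
    (hM : IsBiMult p₁ p₂ p₃ (fun ξη => M (ξη.1 - ξη.2))) :
    (1 / p₃).toReal ≤ (1 / p₁).toReal + (1 / p₂).toReal := by
  by_contra! hlt
  obtain ⟨a, ha⟩ := Function.ne_iff.1 hne
  obtain ⟨K, hK⟩ := hM.exists_bound_packet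
  obtain ⟨S, hS⟩ := (isCompact_closedBall a 4).exists_bound_of_continuousOn hcont.continuousOn
  refine not_tendsto_zero_of_eLpNorm_integral_le (μ := (volume : Measure (ℝ × ℝ))) hp₃
    (f := fun n q => (freqBump q.1 : ℂ) * (freqBump q.2 : ℂ) *
      M (a + ((n : ℝ) + 1)⁻¹ * (q.1 - q.2)))
    (F := fun q => (freqBump q.1 : ℂ) * (freqBump q.2 : ℂ) * M a)
    (u := fun _ q => q.1 + q.2) (U := fun q => q.1 + q.2)
    (bound := fun q => freqBump q.1 * freqBump q.2 * S)
    (fun n => by fun_prop) (by fun_prop) (fun n => by fun_prop) (by fun_prop) (fun q => ?_)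
    (fun q => tendsto_const_nhds) ((integrable_freqBump.mul_prod integrable_freqBump).mul_const S)
    (fun n q => ?_) ?_ (fun n => ?_)
    (tendsto_const_mul_add_one_rpow_neg K (sub_neg.2 hlt))
  · have h : Tendsto (fun n : ℕ => a + ((n : ℝ) + 1)⁻¹ * (q.1 - q.2)) atTop (𝓝 a) := by
      simpa [one_div] using
        (tendsto_one_div_add_atTop_nhds_zero_nat.mul_const (q.1 - q.2)).const_add a
    exact ((hcont.tendsto a).comp h).const_mul _
  · rw [norm_mul, norm_mul, norm_freqBump, norm_freqBump]
    by_cases h : |q.1| < 2 ∧ |q.2| < 2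
    · refine mul_le_mul_of_nonneg_left (hS _ ?_) (mul_nonneg freqBump.nonneg freqBump.nonneg)
      rw [Metric.mem_closedBall, Real.dist_eq, add_sub_cancel_left, abs_mul,
        abs_of_pos (by positivity)]
      have h1 : ((n : ℝ) + 1)⁻¹ ≤ 1 := inv_le_one_of_one_le₀ (by simp)
      have h2 := abs_sub q.1 q.2
      nlinarith [abs_nonneg (q.1 - q.2)]
    · have h0 : freqBump q.1 * freqBump q.2 = 0 := by
        rw [not_and_or, not_lt, not_lt] at h
        rcases h with h | h
        · rw [freqBump.zero_of_le_dist (by simpa [freqBump] using h), zero_mul]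
        · rw [freqBump.zero_of_le_dist (x := q.2) (by simpa [freqBump] using h), mul_zero]
      rw [h0, zero_mul, zero_mul]
  · rw [integral_mul_const, Measure.volume_eq_prod,
      integral_prod_mul (fun x : ℝ => (freqBump x : ℂ)) (fun x : ℝ => (freqBump x : ℂ))]
    exact mul_ne_zero (mul_ne_zero integral_freqBump_ne_zero integral_freqBump_ne_zero) ha
  · have hn : (0 : ℝ) < n + 1 := by positivity
    rw [← eLpNorm_congr_norm_ae (.of_forall (norm_Bm_modulated_packet M hn a))]
    exact hK _ hn a 0 0 0

lemma exponent_sum_le_of_isBiMult {p₁ p₂ p₃ : ℝ≥0∞} (hp₃ : 0 < p₃) {M : ℝ → ℂ}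
    (hcont : Continuous M) (hint : Integrable M) (hne : M ≠ 0)
    (hM : IsBiMult p₁ p₂ p₃ (fun ξη => M (ξη.1 - ξη.2))) :
    (1 / p₁).toReal + (1 / p₂).toReal ≤ (1 / p₃).toReal + 1 := by
  by_contra! hlt
  obtain ⟨t, ht⟩ := exists_integral_unitExp_mul_ne_zero hcont hint hne
  obtain ⟨K, hK⟩ := hM.exists_bound_packet
  refine not_tendsto_zero_of_eLpNorm_integral_le (μ := (volume : Measure (ℝ × ℝ))) hp₃
    (f := fun n q => (freqBump (((n : ℝ) + 1)⁻¹ * q.1 + q.2) : ℂ) * (freqBump q.2 : ℂ) *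
      (unitExp (-(t * q.1)) * M q.1))
    (F := fun q => (freqBump q.2 : ℂ) * (freqBump q.2 : ℂ) * (unitExp (-(t * q.1)) * M q.1))
    (u := fun n q => ((n : ℝ) + 1)⁻¹ * q.1 + 2 * q.2) (U := fun q => 2 * q.2)
    (bound := fun q => ‖M q.1‖ * freqBump q.2)
    (fun n => by fun_prop) (by fun_prop) (fun n => by fun_prop) (by fun_prop) (fun q => ?_)
    (fun q => ?_) (hint.norm.mul_prod integrable_freqBump) (fun n q => ?_) ?_ (fun n => ?_)
    (tendsto_const_mul_add_one_rpow_neg K (sub_neg.2 hlt))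
  · have h : Tendsto (fun n : ℕ => ((n : ℝ) + 1)⁻¹ * q.1 + q.2) atTop (𝓝 q.2) := by
      simpa [one_div] using
        (tendsto_one_div_add_atTop_nhds_zero_nat.mul_const q.1).add_const q.2
    have hb : Continuous fun x : ℝ => (freqBump x : ℂ) := by fun_prop
    exact (((hb.tendsto q.2).comp h).mul_const _).mul_const _
  · simpa [one_div] using
      (tendsto_one_div_add_atTop_nhds_zero_nat.mul_const q.1).add_const (2 * q.2)
  · rw [norm_mul, norm_mul, norm_mul, norm_unitExp, one_mul, norm_freqBump, norm_freqBump,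
      mul_comm ‖M q.1‖]
    exact mul_le_mul_of_nonneg_right
      (mul_le_of_le_one_left freqBump.nonneg (freqBump_le_one _)) (norm_nonneg _)
  · simp_rw [mul_comm ((freqBump _ : ℂ) * _)]
    rw [Measure.volume_eq_prod, integral_prod_mul (fun v => unitExp (-(t * v)) * M v)
      (fun x : ℝ => (freqBump x : ℂ) * (freqBump x : ℂ))]
    exact mul_ne_zero ht integral_freqBump_sq_ne_zero
  · have hn : (0 : ℝ) < n + 1 := by positivity
    have hR : (0 : ℝ) < ((n : ℝ) + 1)⁻¹ := inv_pos.2 hn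
    have h := hK _ hR 0 t 0 (-t)
    simp only [Bm_translated_packet M hR] at h
    have h1 : eLpNorm (fun y => ((((n : ℝ) + 1)⁻¹ : ℝ) : ℂ) * ∫ q : ℝ × ℝ,
        (freqBump (((n : ℝ) + 1)⁻¹ * q.1 + q.2) : ℂ) * (freqBump q.2 : ℂ) *
        (unitExp (-(t * q.1)) * M q.1) * unitExp ((((n : ℝ) + 1)⁻¹ * q.1 + 2 * q.2) * y))
        p₃ volume = _ := eLpNorm_const_smul (((((n : ℝ) + 1)⁻¹ : ℝ) : ℂ)) _ _ _
    rw [h1] at h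
    have h2 : ENNReal.ofReal ((n : ℝ) + 1) * ‖((((n : ℝ) + 1)⁻¹ : ℝ) : ℂ)‖ₑ = 1 := by
      rw [← ofReal_norm, Complex.norm_real, Real.norm_of_nonneg hR.le,
        ← ENNReal.ofReal_mul hn.le, mul_inv_cancel₀ hn.ne', ENNReal.ofReal_one]
    have h3 := mul_le_mul_right h (ENNReal.ofReal ((n : ℝ) + 1))
    rw [← mul_assoc, h2, one_mul] at h3
    refine h3.trans (le_of_eq ?_)
    rw [← ENNReal.ofReal_mul hn.le]
    congr 1
    rw [Real.inv_rpow hn.le, ← Real.rpow_neg hn.le, mul_left_comm, ← Real.rpow_one_add' hn.le]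
    · congr 2
      ring
    · linarith

theorem stmt18 (p₁ p₂ p₃ : ℝ≥0∞) (hp₁ : 1 ≤ p₁) (hp₂ : 1 ≤ p₂) (hp₃ : 0 < p₃)
    (M : ℝ → ℂ) (hcont : Continuous M) (hint : Integrable M) (hne : M ≠ 0)
    (hM : IsBiMult p₁ p₂ p₃ (fun ξη => M (ξη.1 - ξη.2))) :
    1 / p₃ ≤ 1 / p₁ + 1 / p₂ ∧ 1 / p₁ + 1 / p₂ ≤ 1 / p₃ + 1 := by
  have h₁ : 1 / p₁ ≠ ⊤ := by simp [(zero_lt_one.trans_le hp₁).ne']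
  have h₂ : 1 / p₂ ≠ ⊤ := by simp [(zero_lt_one.trans_le hp₂).ne']
  have h₃ : 1 / p₃ ≠ ⊤ := by simp [hp₃.ne']
  constructor
  · rw [← ENNReal.toReal_le_toReal h₃ (ENNReal.add_ne_top.2 ⟨h₁, h₂⟩), ENNReal.toReal_add h₁ h₂]
    exact exponent_target_le_of_isBiMult hp₃ hcont hne hM
  · rw [← ENNReal.toReal_le_toReal (ENNReal.add_ne_top.2 ⟨h₁, h₂⟩)
      (ENNReal.add_ne_top.2 ⟨h₃, one_ne_top⟩), ENNReal.toReal_add h₁ h₂,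
      ENNReal.toReal_add h₃ one_ne_top, ENNReal.toReal_one]
    exact exponent_sum_le_of_isBiMult hp₃ hcont hint hne hM
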